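/- arXiv:2605.14848 — 5 statements merged into one kernel-verified Lean document; each statement's English description precedes it below -/
import Mathlib

section
/- Let m, k₁, k₂ be integers with m ≥ 9 and 2 ≤ k₁ < k₁ + 1 < k₂ ≤ ⌊(m−1)/2⌋, and let f, g be the characteristic-type functions defined from the weight classes A, B, C, D. Then the ternary linear code C_{f,g} is minimal: for all codewords a, b ∈ C_{f,g} with a ≠ 0 and Supp(b) ⊆ Supp(a), there exists λ ∈ F₃ with b = λ·a. -/
open Finset

/-- `ζ₃ = e^{2πi/3}`, a primitive complex cube root of unity. -/
noncomputable def zeta3 : ℂ := Complex.exp (2 * Real.pi * Complex.I / 3)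

/-- `ζ₃^a` for `a ∈ F₃`. -/
noncomputable def chi (a : ZMod 3) : ℂ := zeta3 ^ a.val

/-- Standard inner product on `F₃^m`. -/
def dotp {m : ℕ} (w x : Fin m → ZMod 3) : ZMod 3 := ∑ i, w i * x i

/-- Walsh transform of `F : F₃^m → F₃`. -/
noncomputable def walsh {m : ℕ} (F : (Fin m → ZMod 3) → ZMod 3)
    (w : Fin m → ZMod 3) : ℂ :=
  ∑ x : Fin m → ZMod 3, chi (F x - dotp w x)

/-- Ternary Krawtchouk polynomial `K_t(x,m)`. -/
def Kraw (t x m : ℕ) : ℤ :=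
  ∑ j ∈ Finset.range (t + 1),
    (-1 : ℤ) ^ j * 2 ^ (t - j) * (x.choose j : ℤ) * ((m - x).choose (t - j) : ℤ)

/-- Lloyd polynomial `Ψ_k(x,m) = Σ_{t=0}^k K_t(x,m)`. -/
def Lloyd (k x m : ℕ) : ℤ := ∑ t ∈ Finset.range (k + 1), Kraw t x m

/-- `f(x) = 1` iff `x ∈ A ∪ C ∪ D`, i.e. `1 ≤ wt(x) ≤ k₂` and `wt(x) ≠ k₁`. -/
def ffun (m k₁ k₂ : ℕ) (x : Fin m → ZMod 3) : ZMod 3 :=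
  if 1 ≤ hammingNorm x ∧ hammingNorm x ≤ k₂ ∧ hammingNorm x ≠ k₁ then 1 else 0

/-- `g(x) = 1` on `B ∪ C` (i.e. `k₁ ≤ wt(x) ≤ k₂ - 1`), `g(x) = -1` on `D` (`wt(x) = k₂`). -/
def gfun (m k₁ k₂ : ℕ) (x : Fin m → ZMod 3) : ZMod 3 :=
  if k₁ ≤ hammingNorm x ∧ hammingNorm x ≤ k₂ - 1 then 1
  else if hammingNorm x = k₂ then -1 else 0

/-- The codeword `c(u,r,v)` of `C_{f,g}` for the specific `f = ffun`, `g = gfun`. -/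
def cw (m k₁ k₂ : ℕ) (u r : ZMod 3) (v : Fin m → ZMod 3) :
    {x : Fin m → ZMod 3 // x ≠ 0} → ZMod 3 :=
  fun x => u * ffun m k₁ k₂ x.1 + r * gfun m k₁ k₂ x.1 + dotp v x.1

/-- Hamming weight of the codeword `c(u,r,v)`. -/
def cwt (m k₁ k₂ : ℕ) (u r : ZMod 3) (v : Fin m → ZMod 3) : ℕ :=
  (Finset.univ.filter
    (fun x : {x : Fin m → ZMod 3 // x ≠ 0} => cw m k₁ k₂ u r v x ≠ 0)).card

/-- The linear forms `dotp w` are additive in the argument. -/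
lemma dotp_add_right {m : ℕ} (w x y : Fin m → ZMod 3) :
    dotp w (x + y) = dotp w x + dotp w y :=
  dotProduct_add w x y

lemma dotp_single {m : ℕ} (w : Fin m → ZMod 3) (i : Fin m) (c : ZMod 3) :
    dotp w (Pi.single i c) = w i * c :=
  dotProduct_single w c i

lemma hammingNorm_single_le {m : ℕ} (i : Fin m) (c : ZMod 3) :
    hammingNorm (Pi.single i c : Fin m → ZMod 3) ≤ 1 := by
  refine (card_le_card (t := {i}) fun j hj => ?_).trans (card_singleton i).le
  by_contra h
  simp_all [Pi.single_apply]

lemma hammingNorm_add_le {m : ℕ} (x y : Fin m → ZMod 3) :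
    hammingNorm (x + y) ≤ hammingNorm x + hammingNorm y := by
  refine (card_le_card fun j hj => ?_).trans (card_union_le _ _)
  by_contra h
  simp_all

lemma hammingNorm_le_add {m : ℕ} (x y : Fin m → ZMod 3) :
    hammingNorm x ≤ hammingNorm (x + y) + hammingNorm y := by
  refine (card_le_card fun j hj => ?_).trans (card_union_le _ _)
  by_contra h
  have h' : x j + y j = 0 ∧ y j = 0 := by simpa using h
  exact (mem_filter.mp hj).2 (by simpa [h'.2] using h'.1)

/-- Every hyperplane contains a vector with at most one zero coordinate. -/
lemma exists_dotp_eq_zero_of_large_weight {m : ℕ} (v : Fin m → ZMod 3) :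
    ∃ y, dotp v y = 0 ∧ m ≤ hammingNorm y + 1 := by
  have hone : hammingNorm (1 : Fin m → ZMod 3) = m := by simp [hammingNorm]
  by_cases hv : ∃ i, v i ≠ 0
  · obtain ⟨i, hi⟩ := hv
    refine ⟨1 + Pi.single i (-(v i)⁻¹ * dotp v 1), ?_, ?_⟩
    · rw [dotp_add_right, dotp_single]
      field_simp
      ring
    · have h := hammingNorm_le_add 1 (Pi.single i (-(v i)⁻¹ * dotp v 1))
      have h' := hammingNorm_single_le i (-(v i)⁻¹ * dotp v 1)
      omega
  · push Not at hv
    exact ⟨1, by simp [dotp, hv], by omega⟩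

/-- The vectors of weight at least `m - 3` in a hyperplane span the hyperplane. -/
lemma exists_eq_smul_of_large_weight {m : ℕ} (v w : Fin m → ZMod 3)
    (h : ∀ x, m ≤ hammingNorm x + 3 → dotp v x = 0 → dotp w x = 0) :
    ∃ c : ZMod 3, w = c • v := by
  have key (e : Fin m → ZMod 3) (he : hammingNorm e ≤ 2) (hve : dotp v e = 0) :
      dotp w e = 0 := by
    obtain ⟨y, hvy, hy⟩ := exists_dotp_eq_zero_of_large_weight v
    have hw := h (y + e) (by have := hammingNorm_le_add y e; omega)
      (by rw [dotp_add_right, hvy, hve, add_zero])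
    rwa [dotp_add_right, h y (by omega) hvy, zero_add] at hw
  by_cases hv : ∃ i, v i ≠ 0
  · obtain ⟨i, hi⟩ := hv
    refine ⟨w i / v i, funext fun j => ?_⟩
    have hj := key (Pi.single i (v j) + Pi.single j (-v i))
      ((hammingNorm_add_le _ _).trans
        (Nat.add_le_add (hammingNorm_single_le _ _) (hammingNorm_single_le _ _)))
      (by rw [dotp_add_right, dotp_single, dotp_single]; ring)
    rw [dotp_add_right, dotp_single, dotp_single] at hj
    simp only [Pi.smul_apply, smul_eq_mul]
    field_simp
    linear_combination -hj
  · push Not at hv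
    refine ⟨0, funext fun j => ?_⟩
    have hj := key (Pi.single j 1) ((hammingNorm_single_le _ _).trans one_le_two)
      (by rw [dotp_single, hv, zero_mul])
    simpa [dotp_single] using hj

/-- A vector supported on `T`, with prescribed nonzero entries there, has weight `#T`. -/
lemma exists_hammingNorm_eq_card {m : ℕ} (v s : Fin m → ZMod 3) (T : Finset (Fin m))
    (hs : ∀ i, s i ≠ 0) :
    ∃ x : Fin m → ZMod 3, hammingNorm x = #T ∧ dotp v x = ∑ i ∈ T, v i * s i := by
  refine ⟨fun i => if i ∈ T then s i else 0, ?_, ?_⟩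
  · simp [hammingNorm, hs]
  · simp [dotp]

/-- A nonzero linear form takes every value on the sphere of radius `k`, `2 ≤ k < m`. -/
lemma exists_hammingNorm_eq_dotp_eq {m k : ℕ} (hk : 2 ≤ k) (hkm : k < m)
    (v : Fin m → ZMod 3) (hv : v ≠ 0) (c : ZMod 3) :
    ∃ x : Fin m → ZMod 3, hammingNorm x = k ∧ dotp v x = c := by
  obtain ⟨i, hi⟩ := Function.ne_iff.mp hv
  replace hi : v i ≠ 0 := hi
  by_cases hj : ∃ j, j ≠ i ∧ v j ≠ 0
  · obtain ⟨j, hji, hj⟩ := hj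
    obtain ⟨T, hT, hTk⟩ := exists_subset_card_eq
      (s := ((univ.erase i).erase j : Finset (Fin m))) (n := k - 2)
      (by rw [card_erase_of_mem (by simp [hji]), card_erase_of_mem (mem_univ _), card_univ,
            Fintype.card_fin]; omega)
    have hiT : i ∉ T := fun h => by simpa using hT h
    have hjT : j ∉ T := fun h => by simpa using hT h
    have solve : ∀ p q d : ZMod 3, p ≠ 0 → q ≠ 0 →
        ∃ α β : ZMod 3, α ≠ 0 ∧ β ≠ 0 ∧ p * α + q * β = d := by decide
    obtain ⟨α, β, hα, hβ, h⟩ := solve (v i) (v j) (c - ∑ l ∈ T, v l) hi hj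
    obtain ⟨x, hx, hvx⟩ := exists_hammingNorm_eq_card v
      (fun l => if l = i then α else if l = j then β else 1) (insert i (insert j T))
      (fun l => by split_ifs <;> simp_all)
    refine ⟨x, ?_, ?_⟩
    · rw [hx, card_insert_of_notMem (by simp [hiT, hji.symm]), card_insert_of_notMem hjT]
      omega
    · have hsum : ∑ l ∈ T, v l * (if l = i then α else if l = j then β else 1) =
          ∑ l ∈ T, v l := sum_congr rfl fun l hl => by
        rw [if_neg (ne_of_mem_of_not_mem hl hiT), if_neg (ne_of_mem_of_not_mem hl hjT), mul_one]
      rw [hvx, sum_insert (by simp [hiT, hji.symm]), sum_insert hjT, hsum]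
      simp only [if_true, if_neg hji]
      linear_combination h
  · push Not at hj
    have hcard : #(univ.erase i : Finset (Fin m)) = m - 1 := by simp
    by_cases hc : c = 0
    · obtain ⟨T, hT, hTk⟩ := exists_subset_card_eq
        (s := (univ.erase i : Finset (Fin m))) (n := k) (by omega)
      obtain ⟨x, hx, hvx⟩ := exists_hammingNorm_eq_card v 1 T (by simp)
      refine ⟨x, hx.trans hTk, ?_⟩
      rw [hvx, hc]
      exact sum_eq_zero fun l hl => by rw [hj l (ne_of_mem_erase (hT hl)), zero_mul]
    · obtain ⟨T, hT, hTk⟩ := exists_subset_card_eq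
        (s := (univ.erase i : Finset (Fin m))) (n := k - 1) (by omega)
      have hiT : i ∉ T := fun h => by simpa using hT h
      obtain ⟨x, hx, hvx⟩ := exists_hammingNorm_eq_card v
        (fun _ => c / v i) (insert i T) (fun _ => div_ne_zero hc hi)
      refine ⟨x, ?_, ?_⟩
      · rw [hx, card_insert_of_notMem hiT]
        omega
      · rw [hvx, sum_insert hiT, sum_eq_zero fun l hl => by
          rw [hj l (ne_of_mem_erase (hT hl)), zero_mul], add_zero, mul_div_cancel₀ c hi]

/-- The four weight classes already determine `(u, r)` up to a scalar. -/
lemma exists_scalar_of_vanishing (u r u' r' : ZMod 3) (hA : u = 0 → u' = 0)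
    (hB : r = 0 → r' = 0) (hC : u + r = 0 → u' + r' = 0) (hD : u - r = 0 → u' - r' = 0) :
    ∃ c : ZMod 3, u' = c * u ∧ r' = c * r := by
  revert u r u' r'
  decide

theorem stmt14 (m k₁ k₂ : ℕ) (hm : 9 ≤ m) (hk₁ : 2 ≤ k₁) (hk : k₁ + 1 < k₂)
    (hk₂ : k₂ ≤ (m - 1) / 2) :
    ∀ a ∈ Set.range (fun urv : ZMod 3 × ZMod 3 × (Fin m → ZMod 3) =>
        cw m k₁ k₂ urv.1 urv.2.1 urv.2.2),
      ∀ b ∈ Set.range (fun urv : ZMod 3 × ZMod 3 × (Fin m → ZMod 3) =>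
        cw m k₁ k₂ urv.1 urv.2.1 urv.2.2),
        a ≠ 0 → (∀ x, b x ≠ 0 → a x ≠ 0) → ∃ lam : ZMod 3, b = lam • a := by
  rintro _ ⟨⟨u, r, v⟩, rfl⟩ _ ⟨⟨u', r', w⟩, rfl⟩ - hab
  dsimp only at hab ⊢
  have hzero (x : Fin m → ZMod 3) (hx : 1 ≤ hammingNorm x)
      (ha : u * ffun m k₁ k₂ x + r * gfun m k₁ k₂ x + dotp v x = 0) :
      u' * ffun m k₁ k₂ x + r' * gfun m k₁ k₂ x + dotp w x = 0 :=
    not_imp_not.mp (hab ⟨x, hammingNorm_ne_zero_iff.mp (by omega)⟩) ha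
  obtain ⟨c, rfl⟩ : ∃ c : ZMod 3, w = c • v := by
    refine exists_eq_smul_of_large_weight v w fun x hx hvx => ?_
    have hf : ffun m k₁ k₂ x = 0 := if_neg (by omega)
    have hg : gfun m k₁ k₂ x = 0 := by
      rw [gfun, if_neg (by omega), if_neg (by omega)]
    simpa [hf, hg] using hzero x (by omega) (by simp [hf, hg, hvx])
  have hsmul (x : Fin m → ZMod 3) : dotp (c • v) x = c * dotp v x := smul_dotProduct c v x
  simp only [hsmul] at hzero
  have hB (x : Fin m → ZMod 3) (hx : hammingNorm x = k₁) (h : r + dotp v x = 0) :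
      r' + c * dotp v x = 0 := by
    have hf : ffun m k₁ k₂ x = 0 := if_neg (by omega)
    have hg : gfun m k₁ k₂ x = 1 := if_pos (by omega)
    simpa [hf, hg] using hzero x (by omega) (by simpa [hf, hg] using h)
  have hC (x : Fin m → ZMod 3) (hx : hammingNorm x = k₁ + 1) (h : u + r + dotp v x = 0) :
      u' + r' + c * dotp v x = 0 := by
    have hf : ffun m k₁ k₂ x = 1 := if_pos (by omega)
    have hg : gfun m k₁ k₂ x = 1 := if_pos (by omega)
    simpa [hf, hg] using hzero x (by omega) (by simpa [hf, hg] using h)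
  suffices ∃ d : ZMod 3, u' = d * u ∧ r' = d * r ∧ ∀ i, c * v i = d * v i by
    obtain ⟨d, rfl, rfl, hd⟩ := this
    refine ⟨d, funext fun x => ?_⟩
    rw [show c • v = d • v from funext hd]
    have hx : dotp (d • v) x.1 = d * dotp v x.1 := smul_dotProduct d v x.1
    simp only [cw, Pi.smul_apply, smul_eq_mul, hx]
    ring
  by_cases hv : v = 0
  · subst hv
    have hdot (x : Fin m → ZMod 3) : dotp 0 x = 0 := zero_dotProduct x
    have hsphere (k : ℕ) (hk : k ≤ m) : ∃ x : Fin m → ZMod 3, hammingNorm x = k := by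
      obtain ⟨T, -, hT⟩ := exists_subset_card_eq (s := (univ : Finset (Fin m))) (n := k)
        (by simpa using hk)
      obtain ⟨x, hx, -⟩ := exists_hammingNorm_eq_card 0 1 T (by simp)
      exact ⟨x, hx.trans hT⟩
    simp only [hdot, mul_zero, add_zero] at hzero hB hC
    obtain ⟨xA, hxA⟩ := hsphere 1 (by omega)
    obtain ⟨xB, hxB⟩ := hsphere k₁ (by omega)
    obtain ⟨xC, hxC⟩ := hsphere (k₁ + 1) (by omega)
    obtain ⟨xD, hxD⟩ := hsphere k₂ (by omega)
    have hfA : ffun m k₁ k₂ xA = 1 := if_pos (by omega)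
    have hgA : gfun m k₁ k₂ xA = 0 := by
      rw [gfun, if_neg (by omega), if_neg (by omega)]
    have hfD : ffun m k₁ k₂ xD = 1 := if_pos (by omega)
    have hgD : gfun m k₁ k₂ xD = -1 := by
      rw [gfun, if_neg (by omega), if_pos hxD]
    obtain ⟨d, hu, hr⟩ := exists_scalar_of_vanishing u r u' r'
      (by simpa [hfA, hgA] using hzero xA (by omega)) (hB xB hxB) (hC xC hxC)
      (by simpa [hfD, hgD, sub_eq_add_neg] using hzero xD (by omega))
    exact ⟨d, hu, hr, by simp⟩
  · obtain ⟨xB, hxB, hvB⟩ :=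
      exists_hammingNorm_eq_dotp_eq (k := k₁) (by omega) (by omega) v hv (-r)
    obtain ⟨xC, hxC, hvC⟩ :=
      exists_hammingNorm_eq_dotp_eq (k := k₁ + 1) (by omega) (by omega) v hv (-(u + r))
    have hr := hB xB hxB (by rw [hvB]; ring)
    have hu := hC xC hxC (by rw [hvC]; ring)
    rw [hvB] at hr
    rw [hvC] at hu
    exact ⟨c, by linear_combination hu - hr, by linear_combination hr, fun _ => rfl⟩
end

section
/- Let m, k₁, k₂ be integers with m ≥ 9 and 2 ≤ k₁ < k₁ + 1 < k₂ ≤ ⌊(m−1)/2⌋, and let f, g be the characteristic-type functions defined from the weight classes A, B, C, D. Then the maximum Hamming weight over all nonzero codewords of the code C_{f,g} equals 3^m − 3^{m−1} + 2^{k₂}·C(m−1,k₂) − 2^{k₁−1}·C(m−1,k₁−1). -/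
open Finset

/-- The generating polynomial `(1 - X)^w (1 + 2X)^e` of the ternary Krawtchouk numbers. -/
noncomputable def krawPoly (w e : ℕ) : Polynomial ℤ :=
  (1 - Polynomial.X) ^ w * (1 + 2 * Polynomial.X) ^ e

/-- The ternary Krawtchouk number `K_t(w, w + e)`, as a coefficient of `krawPoly w e`. -/
noncomputable def krawCoeff (w e t : ℕ) : ℤ := (krawPoly w e).coeff t

/-- The real character sum `ζ₃^a + ζ₃^(-a)` of `a ∈ F₃`. -/
def realChar (a : ZMod 3) : ℤ := if a = 0 then 2 else -1

lemma krawCoeff_zero (w e : ℕ) : krawCoeff w e 0 = 1 := by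
  simp [krawCoeff, krawPoly, Polynomial.coeff_zero_eq_eval_zero]

lemma krawCoeff_succ_left (w e t : ℕ) :
    krawCoeff (w + 1) e (t + 1) = krawCoeff w e (t + 1) - krawCoeff w e t := by
  have h : krawPoly (w + 1) e = krawPoly w e - krawPoly w e * Polynomial.X := by
    unfold krawPoly; ring
  simp [krawCoeff, h, Polynomial.coeff_mul_X]

lemma krawCoeff_succ_right (w e t : ℕ) :
    krawCoeff w (e + 1) (t + 1) = krawCoeff w e (t + 1) + 2 * krawCoeff w e t := by
  have h : krawPoly w (e + 1)
      = krawPoly w e + (krawPoly w e + krawPoly w e) * Polynomial.X := by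
    unfold krawPoly; ring
  simp [krawCoeff, h, Polynomial.coeff_mul_X]
  ring

lemma krawCoeff_zero_left (M t : ℕ) : krawCoeff 0 M t = 2 ^ t * (M.choose t : ℤ) := by
  induction M generalizing t with
  | zero =>
    cases t with
    | zero => simp [krawCoeff_zero]
    | succ t => simp [krawCoeff, krawPoly, Polynomial.coeff_one]
  | succ M ih =>
    cases t with
    | zero => simp [krawCoeff_zero]
    | succ t =>
      rw [krawCoeff_succ_right, ih, ih, Nat.choose_succ_succ]
      push_cast
      ring

lemma krawCoeff_zero_left_nonneg (M t : ℕ) : 0 ≤ krawCoeff 0 M t := by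
  rw [krawCoeff_zero_left]; positivity

/-- A Krawtchouk number lies between `-a / 2` and `a`, where `a` is the size of the sphere. -/
lemma krawCoeff_bounds (w e t : ℕ) :
    -krawCoeff 0 (w + e) t ≤ 2 * krawCoeff w e t ∧
      krawCoeff w e t ≤ krawCoeff 0 (w + e) t := by
  induction w generalizing t with
  | zero =>
    have := krawCoeff_zero_left_nonneg e t
    simp only [zero_add]
    constructor <;> linarith
  | succ w ih =>
    cases t with
    | zero => simp [krawCoeff_zero]
    | succ t =>
      have h0 := krawCoeff_zero_left_nonneg (w + e) t
      obtain ⟨h1, h2⟩ := ih (t + 1)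
      obtain ⟨h3, h4⟩ := ih t
      rw [show w + 1 + e = w + e + 1 by ring, krawCoeff_succ_left, krawCoeff_succ_right]
      constructor <;> linarith

lemma two_mul_krawCoeff_le {M t : ℕ} (h : 2 * t + 1 ≤ M) :
    2 * krawCoeff 0 M t ≤ krawCoeff 0 M (t + 1) := by
  have hc : M.choose t ≤ M.choose (t + 1) := by
    have h1 := Nat.choose_succ_right_eq M t
    have h2 : M.choose t * (t + 1) ≤ M.choose t * (M - t) :=
      Nat.mul_le_mul_left _ (by omega)
    exact Nat.le_of_mul_le_mul_right (h1 ▸ h2) (Nat.succ_pos t)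
  have hc' : (M.choose t : ℤ) ≤ M.choose (t + 1) := by exact_mod_cast hc
  rw [krawCoeff_zero_left, krawCoeff_zero_left, pow_succ]
  have : (0 : ℤ) < 2 ^ t := by positivity
  nlinarith

lemma krawCoeff_zero_left_mono {M t d : ℕ} (h : 2 * (t + d) ≤ M + 1) :
    krawCoeff 0 M t ≤ krawCoeff 0 M (t + d) := by
  induction d with
  | zero => simp
  | succ d ih =>
    have h1 := ih (by omega)
    have h2 := two_mul_krawCoeff_le (M := M) (t := t + d) (by omega)
    have h3 := krawCoeff_zero_left_nonneg M (t + d)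
    rw [← add_assoc]
    linarith

lemma krawCoeff_succ_le_two_mul {M t : ℕ} (h : 2 * t ≤ M + 1) :
    krawCoeff 0 (M + 1) t ≤ 2 * krawCoeff 0 M t := by
  cases t with
  | zero => simp [krawCoeff_zero]
  | succ t =>
    rw [krawCoeff_succ_right]
    linarith [two_mul_krawCoeff_le (M := M) (t := t) (by omega)]

/-- Partial sums of Krawtchouk numbers are again Krawtchouk numbers. -/
lemma sum_krawCoeff (w e j : ℕ) :
    ∑ t ∈ range (j + 1), krawCoeff (w + 1) e t = krawCoeff w e j := by
  induction j with
  | zero => simp [krawCoeff_zero]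
  | succ j ih => rw [sum_range_succ, ih, krawCoeff_succ_left]; ring

lemma sum_krawCoeff_le {M k : ℕ} (h : 2 * k ≤ M + 1) :
    ∑ t ∈ range (k + 1), krawCoeff 0 M t ≤ 2 * krawCoeff 0 M k := by
  induction k with
  | zero => simp [krawCoeff_zero]
  | succ k ih =>
    rw [sum_range_succ]
    linarith [ih (by omega), two_mul_krawCoeff_le (M := M) (t := k) (by omega)]

lemma natDegree_krawPoly_lt (w e : ℕ) : (krawPoly w e).natDegree < w + e + 1 := by
  have : (krawPoly w e).natDegree ≤ w * 1 + e * 1 := by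
    unfold krawPoly
    refine Polynomial.natDegree_mul_le_of_le (Polynomial.natDegree_pow_le_of_le w ?_)
      (Polynomial.natDegree_pow_le_of_le e ?_) <;> compute_degree
  omega

lemma sum_krawCoeff_all (w e : ℕ) :
    ∑ t ∈ range (w + e + 1), krawCoeff w e t = 0 ^ w * 3 ^ e := by
  have h := Polynomial.eval_eq_sum_range' (natDegree_krawPoly_lt w e) (1 : ℤ)
  simp only [one_pow, mul_one] at h
  unfold krawCoeff
  rw [← h]
  norm_num [krawPoly]

section CharacterSums

open Polynomial

lemma hammingNorm_cons {m : ℕ} (a : ZMod 3) (x : Fin m → ZMod 3) :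
    hammingNorm (Fin.cons a x : Fin (m + 1) → ZMod 3)
      = (if a = 0 then 0 else 1) + hammingNorm x := by
  simp only [hammingNorm, card_filter, Fin.sum_univ_succ, Fin.cons_zero, Fin.cons_succ]
  split_ifs <;> simp_all

lemma sum_realChar_monomial {m : ℕ} (v : Fin m → ZMod 3) (h : ZMod 3) :
    ∑ x : Fin m → ZMod 3, C (realChar (h + dotp v x)) * (X : ℤ[X]) ^ hammingNorm x
      = C (realChar h) * ∏ i, (if v i = 0 then 1 + 2 * X else 1 - X) := by
  induction m generalizing h with
  | zero => simp [dotp, hammingNorm]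
  | succ m ih =>
    rw [← (Fin.consEquiv fun _ : Fin (m + 1) => ZMod 3).sum_comp, Fintype.sum_prod_type,
      Fin.prod_univ_succ]
    have hstep (a : ZMod 3) : ∑ x : Fin m → ZMod 3,
        C (realChar (h + dotp v (Fin.consEquiv (fun _ : Fin (m + 1) => ZMod 3) (a, x))))
          * (X : ℤ[X]) ^ hammingNorm (Fin.consEquiv (fun _ : Fin (m + 1) => ZMod 3) (a, x))
        = X ^ (if a = 0 then 0 else 1) * (C (realChar (h + v 0 * a))
          * ∏ i : Fin m, (if v i.succ = 0 then 1 + 2 * X else 1 - X)) := by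
      have htail : ∑ x : Fin m → ZMod 3,
          C (realChar (h + v 0 * a + dotp (Fin.tail v) x)) * (X : ℤ[X]) ^ hammingNorm x
          = C (realChar (h + v 0 * a))
            * ∏ i : Fin m, (if v i.succ = 0 then 1 + 2 * X else 1 - X) := ih (Fin.tail v) _
      rw [← htail, mul_sum]
      refine sum_congr rfl fun x _ => ?_
      have h1 : Fin.consEquiv (fun _ : Fin (m + 1) => ZMod 3) (a, x) = Fin.cons a x := rfl
      have h2 : dotp v (Fin.cons a x) = v 0 * a + dotp (Fin.tail v) x := by
        simp [dotp, Fin.sum_univ_succ, Fin.tail]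
      rw [h1, h2, hammingNorm_cons, pow_add, add_assoc]
      ring
    simp only [hstep]
    generalize (∏ i : Fin m, (if v i.succ = 0 then (1 + 2 * X : ℤ[X]) else 1 - X)) = P
    generalize v 0 = c
    have hsum (F : ZMod 3 → ℤ[X]) : ∑ a, F a = F 0 + F 1 + F 2 := Fin.sum_univ_three F
    have h10 : (1 : ZMod 3) ≠ 0 := by decide
    have h20 : (2 : ZMod 3) ≠ 0 := by decide
    rw [hsum, if_pos rfl, if_neg h10, if_neg h20]
    by_cases hc : c = 0
    · subst hc
      simp
      ring
    · have hr : realChar (h + c * 0) = realChar h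
          ∧ realChar (h + c * 1) + realChar (h + c * 2) = -realChar h := by
        clear hstep
        revert h c; decide
      have hr2 : realChar (h + c * 2) = -realChar h - realChar (h + c * 1) := by
        linarith [hr.2]
      rw [if_neg hc, hr.1, hr2]
      simp only [map_sub, map_neg]
      ring

lemma prod_eq_krawPoly {m : ℕ} (v : Fin m → ZMod 3) :
    (∏ i, (if v i = 0 then 1 + 2 * X else 1 - X) : ℤ[X])
      = krawPoly (hammingNorm v) (m - hammingNorm v) := by
  have hcard : (univ.filter fun i => v i = 0).card = m - hammingNorm v := by
    have := card_filter_add_card_filter_not (s := (univ : Finset (Fin m))) fun i => v i = 0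
    simp only [card_univ, Fintype.card_fin] at this
    simp only [hammingNorm, ne_eq]
    omega
  rw [prod_ite, prod_const, prod_const, hcard, krawPoly, mul_comm]
  rfl

lemma sum_sphere_realChar {m : ℕ} (v : Fin m → ZMod 3) (h : ZMod 3) (t : ℕ) :
    ∑ x : Fin m → ZMod 3, (if hammingNorm x = t then realChar (h + dotp v x) else 0)
      = realChar h * krawCoeff (hammingNorm v) (m - hammingNorm v) t := by
  have key := congrArg (coeff · t) (sum_realChar_monomial v h)
  simp only [finsetSum_coeff, coeff_C_mul, coeff_X_pow, prod_eq_krawPoly] at key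
  rw [krawCoeff, ← key]
  refine sum_congr rfl fun x _ => ?_
  simp [eq_comm]

end CharacterSums

lemma hammingNorm_le {m : ℕ} (x : Fin m → ZMod 3) : hammingNorm x ≤ m := by
  simpa using hammingNorm_le_card_fintype (x := x)

lemma sum_realChar_weight {m : ℕ} (v : Fin m → ZMod 3) (H : ℕ → ZMod 3) :
    ∑ x : Fin m → ZMod 3, realChar (H (hammingNorm x) + dotp v x)
      = ∑ t ∈ range (m + 1),
          realChar (H t) * krawCoeff (hammingNorm v) (m - hammingNorm v) t := by
  simp only [← sum_sphere_realChar]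
  rw [sum_comm]
  refine sum_congr rfl fun x _ => ?_
  rw [sum_ite_eq, if_pos (mem_range.2 (Nat.lt_succ_of_le (hammingNorm_le x)))]

/-- The value of `u f + r g` at a vector of weight `t`. -/
def radial (k₁ k₂ : ℕ) (u r : ZMod 3) (t : ℕ) : ZMod 3 :=
  u * (if 1 ≤ t ∧ t ≤ k₂ ∧ t ≠ k₁ then 1 else 0)
    + r * (if k₁ ≤ t ∧ t ≤ k₂ - 1 then 1 else if t = k₂ then -1 else 0)

lemma cwt_eq_sum {m k₁ k₂ : ℕ} (hk₁ : 1 ≤ k₁) (hk : k₁ < k₂) (u r : ZMod 3)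
    (v : Fin m → ZMod 3) :
    3 * (cwt m k₁ k₂ u r v : ℤ)
      = ∑ x : Fin m → ZMod 3,
          (2 - realChar (radial k₁ k₂ u r (hammingNorm x) + dotp v x)) := by
  have hterm (a : ZMod 3) : 2 - realChar a = 3 * if a ≠ 0 then 1 else 0 := by
    revert a; decide
  have h0 : radial k₁ k₂ u r (hammingNorm (0 : Fin m → ZMod 3)) + dotp v 0 = 0 := by
    have h1 : ¬ k₁ ≤ 0 := by omega
    have h2 : ¬ 0 = k₂ := by omega
    simp [radial, dotp, h1, h2]
  rw [← sum_filter_of_ne (p := fun x : Fin m → ZMod 3 => x ≠ 0)]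
  · rw [sum_subtype (p := fun x : Fin m → ZMod 3 => x ≠ 0) _ (by simp)]
    simp only [hterm, ← mul_sum]
    congr 1
    rw [cwt, card_filter]
    push_cast
    rfl
  · rintro x - hx rfl
    rw [h0] at hx
    simp [realChar] at hx

lemma three_mul_cwt {m k₁ k₂ : ℕ} (hk₁ : 1 ≤ k₁) (hk : k₁ < k₂) (u r : ZMod 3)
    (v : Fin m → ZMod 3) :
    3 * (cwt m k₁ k₂ u r v : ℤ)
      = 2 * 3 ^ m - 2 * (0 ^ hammingNorm v * 3 ^ (m - hammingNorm v))
        + 3 * ∑ t ∈ range (m + 1), (if radial k₁ k₂ u r t ≠ 0 then 1 else 0)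
          * krawCoeff (hammingNorm v) (m - hammingNorm v) t := by
  have hchar (a : ZMod 3) : realChar a = 2 - 3 * if a ≠ 0 then 1 else 0 := by
    revert a; decide
  have hall := sum_krawCoeff_all (hammingNorm v) (m - hammingNorm v)
  rw [Nat.add_sub_cancel' (hammingNorm_le v)] at hall
  rw [cwt_eq_sum hk₁ hk, sum_sub_distrib, sum_realChar_weight, ← hall]
  simp only [hchar, sub_mul, sum_sub_distrib, mul_assoc, ← mul_sum]
  simp
  ring

lemma sum_range_indicator {m j : ℕ} (hj : j ≤ m + 1) (F : ℕ → ℤ) :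
    ∑ t ∈ range (m + 1), (if t < j then 1 else 0) * F t = ∑ t ∈ range j, F t := by
  simp only [ite_mul, one_mul, zero_mul, ← sum_filter]
  congr 1
  ext t
  simp only [mem_filter, mem_range]
  omega

lemma sum_radial {m k₁ k₂ : ℕ} (hk₁ : 1 ≤ k₁) (hk : k₁ < k₂) (hk₂ : k₂ ≤ m)
    (u r : ZMod 3) (F : ℕ → ℤ) :
    ∑ t ∈ range (m + 1), (if radial k₁ k₂ u r t ≠ 0 then 1 else 0) * F t
      = (if u ≠ 0 then 1 else 0) * (∑ t ∈ range k₁, F t - F 0)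
        + (if r ≠ 0 then 1 else 0) * (∑ t ∈ range (k₁ + 1), F t - ∑ t ∈ range k₁, F t)
        + (if u + r ≠ 0 then 1 else 0)
          * (∑ t ∈ range k₂, F t - ∑ t ∈ range (k₁ + 1), F t)
        + (if u - r ≠ 0 then 1 else 0)
          * (∑ t ∈ range (k₂ + 1), F t - ∑ t ∈ range k₂, F t) := by
  rw [← sum_range_one F]
  simp only [← sum_range_indicator (show 1 ≤ m + 1 by omega) F,
    ← sum_range_indicator (show k₁ ≤ m + 1 by omega) F,
    ← sum_range_indicator (show k₁ + 1 ≤ m + 1 by omega) F,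
    ← sum_range_indicator (show k₂ ≤ m + 1 by omega) F,
    ← sum_range_indicator (show k₂ + 1 ≤ m + 1 by omega) F,
    ← sum_sub_distrib, mul_sum, ← sum_add_distrib]
  refine sum_congr rfl fun t _ => ?_
  have hval : radial k₁ k₂ u r t = if t < 1 then 0 else if t < k₁ then u
      else if t < k₁ + 1 then r else if t < k₂ then u + r
      else if t < k₂ + 1 then u - r else 0 := by
    unfold radial
    split_ifs <;> first | omega | ring
  rw [hval]
  rcases lt_or_ge t 1 with h | h
  · have h1 : t < k₁ := by omega
    have h2 : t < k₁ + 1 := by omega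
    have h3 : t < k₂ := by omega
    have h4 : t < k₂ + 1 := by omega
    simp [h, h1, h2, h3, h4]
  rw [if_neg (not_lt.2 h), if_neg (not_lt.2 h)]
  rcases lt_or_ge t k₁ with h1 | h1
  · have h2 : t < k₁ + 1 := by omega
    have h3 : t < k₂ := by omega
    have h4 : t < k₂ + 1 := by omega
    simp [h1, h2, h3, h4]
  rw [if_neg (not_lt.2 h1), if_neg (not_lt.2 h1)]
  rcases lt_or_ge t (k₁ + 1) with h2 | h2
  · have h3 : t < k₂ := by omega
    have h4 : t < k₂ + 1 := by omega
    simp [h2, h3, h4]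
  rw [if_neg (not_lt.2 h2), if_neg (not_lt.2 h2)]
  rcases lt_or_ge t k₂ with h3 | h3
  · have h4 : t < k₂ + 1 := by omega
    simp [h3, h4]
  rw [if_neg (not_lt.2 h3), if_neg (not_lt.2 h3)]
  split_ifs <;> simp_all

/-- The weight of a codeword with `v ≠ 0`, in terms of Krawtchouk numbers. -/
lemma cwt_of_hammingNorm_eq_succ {m k₁ k₂ s e : ℕ} (hk₁ : 2 ≤ k₁) (hk : k₁ + 1 < k₂)
    (hk₂ : k₂ ≤ m) (u r : ZMod 3) {v : Fin m → ZMod 3} (hv : hammingNorm v = s + 1)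
    (hm : m = s + 1 + e) :
    (cwt m k₁ k₂ u r v : ℤ) = 3 ^ m - 3 ^ (m - 1)
      + ((if u ≠ 0 then 1 else 0) * (krawCoeff s e (k₁ - 1) - 1)
        + (if r ≠ 0 then 1 else 0) * (krawCoeff s e k₁ - krawCoeff s e (k₁ - 1))
        + (if u + r ≠ 0 then 1 else 0) * (krawCoeff s e (k₂ - 1) - krawCoeff s e k₁)
        + (if u - r ≠ 0 then 1 else 0) * (krawCoeff s e k₂ - krawCoeff s e (k₂ - 1))) := by
  have h := three_mul_cwt (by omega : 1 ≤ k₁) (by omega : k₁ < k₂) u r v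
  have he : m - (s + 1) = e := by omega
  rw [sum_radial (by omega) (by omega) hk₂, hv, he, krawCoeff_zero] at h
  obtain ⟨a, rfl⟩ : ∃ a, k₁ = a + 1 := ⟨k₁ - 1, by omega⟩
  obtain ⟨b, rfl⟩ : ∃ b, k₂ = b + 1 := ⟨k₂ - 1, by omega⟩
  simp only [sum_krawCoeff, Nat.add_sub_cancel] at h ⊢
  have hpow : (3 : ℤ) ^ m = 3 * 3 ^ (m - 1) := by
    rw [← pow_succ']; congr 1; omega
  rw [zero_pow (Nat.succ_ne_zero s)] at h
  linarith

/-- Combinations of Krawtchouk numbers occurring as weights are largest at `s = 0`. -/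
lemma krawCoeff_combination_le {k₁ k₂ s e : ℕ} (hk₁ : 2 ≤ k₁) (hk : k₁ + 1 < k₂)
    (hk₂ : 2 * k₂ ≤ s + e) :
    0 ≤ krawCoeff 0 (s + e) k₂ - krawCoeff 0 (s + e) (k₁ - 1) ∧
    krawCoeff s e k₂ - krawCoeff s e (k₁ - 1)
      ≤ krawCoeff 0 (s + e) k₂ - krawCoeff 0 (s + e) (k₁ - 1) ∧
    krawCoeff s e (k₁ - 1) - 1 + krawCoeff s e k₂ - krawCoeff s e k₁
      ≤ krawCoeff 0 (s + e) k₂ - krawCoeff 0 (s + e) (k₁ - 1) ∧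
    krawCoeff s e (k₂ - 1) - 1
      ≤ krawCoeff 0 (s + e) k₂ - krawCoeff 0 (s + e) (k₁ - 1) ∧
    krawCoeff s e k₁ - 1 + krawCoeff s e k₂ - krawCoeff s e (k₂ - 1)
      ≤ krawCoeff 0 (s + e) k₂ - krawCoeff 0 (s + e) (k₁ - 1) := by
  obtain ⟨j, rfl⟩ : ∃ j, k₁ = j + 2 := ⟨k₁ - 2, by omega⟩
  obtain ⟨d, rfl⟩ : ∃ d, k₂ = j + d + 4 := ⟨k₂ - (j + 4), by omega⟩
  rw [show j + 2 - 1 = j + 1 by omega, show j + d + 4 - 1 = j + d + 3 by omega]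
  -- doubling inequalities along the relevant spheres
  have growth (M : ℕ) (hM : 2 * (j + d) + 5 ≤ M) :
      0 ≤ krawCoeff 0 M j ∧
      2 * krawCoeff 0 M j ≤ krawCoeff 0 M (j + 1) ∧
      2 * krawCoeff 0 M (j + 1) ≤ krawCoeff 0 M (j + 2) ∧
      2 * krawCoeff 0 M (j + 2) ≤ krawCoeff 0 M (j + 3) ∧
      krawCoeff 0 M (j + 3) ≤ krawCoeff 0 M (j + d + 3) ∧
      0 ≤ krawCoeff 0 M (j + d + 1) ∧
      2 * krawCoeff 0 M (j + d + 1) ≤ krawCoeff 0 M (j + d + 2) ∧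
      2 * krawCoeff 0 M (j + d + 2) ≤ krawCoeff 0 M (j + d + 3) := by
    refine ⟨krawCoeff_zero_left_nonneg _ _, two_mul_krawCoeff_le (by omega),
      two_mul_krawCoeff_le (by omega), two_mul_krawCoeff_le (by omega), ?_,
      krawCoeff_zero_left_nonneg _ _, two_mul_krawCoeff_le (by omega),
      two_mul_krawCoeff_le (by omega)⟩
    have := krawCoeff_zero_left_mono (M := M) (t := j + 3) (d := d) (by omega)
    rwa [show j + 3 + d = j + d + 3 by ring] at this
  have htop : 2 * krawCoeff 0 (s + e) (j + d + 3) ≤ krawCoeff 0 (s + e) (j + d + 4) :=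
    two_mul_krawCoeff_le (by omega)
  obtain ⟨g1, g2, g3, g4, g5, g6, g7, g8⟩ := growth (s + e) (by omega)
  cases s with
  | zero =>
    simp only [zero_add] at *
    refine ⟨?_, ?_, ?_, ?_, ?_⟩ <;> linarith
  | succ s =>
    obtain ⟨p1, p2, p3, p4, p5, p6, p7, p8⟩ := growth (s + e) (by omega)
    have b4 := krawCoeff_bounds (s + 1) e (j + d + 3)
    refine ⟨by linarith, ?_, ?_, by linarith, ?_⟩
    · have c1 := krawCoeff_bounds s e (j + d + 4)
      have c2 := krawCoeff_bounds s e (j + d + 3)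
      have c3 := krawCoeff_bounds (s + 1) e (j + 1)
      have hd := krawCoeff_succ_le_two_mul (M := s + e) (t := j + 1) (by omega)
      simp only [show s + 1 + e = s + e + 1 by ring] at *
      rw [krawCoeff_succ_left, krawCoeff_succ_right 0 (s + e) (j + d + 3)]
      linarith
    · have c1 := krawCoeff_bounds s e (j + d + 4)
      have c2 := krawCoeff_bounds s e (j + d + 3)
      have c3 := krawCoeff_bounds (s + 1) e (j + 1)
      have c4 := krawCoeff_bounds (s + 1) e (j + 2)
      have hd := krawCoeff_succ_le_two_mul (M := s + e) (t := j + 1) (by omega)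
      have hd' := krawCoeff_succ_right 0 (s + e) (j + 1)
      simp only [show s + 1 + e = s + e + 1 by ring] at *
      rw [krawCoeff_succ_left s e (j + d + 3), krawCoeff_succ_right 0 (s + e) (j + d + 3)]
      linarith
    · have hj := krawCoeff_succ_right 0 (s + e) j
      cases s with
      | zero =>
        simp only [zero_add, show 1 + e = e + 1 by ring] at *
        rw [krawCoeff_succ_left 0 e (j + 1), krawCoeff_succ_left 0 e (j + d + 3),
          krawCoeff_succ_left 0 e (j + d + 2), krawCoeff_succ_right 0 e (j + d + 3), hj]
        linarith
      | succ s =>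
        obtain ⟨q1, q2, q3, q4, q5, q6, q7, q8⟩ := growth (s + e) (by omega)
        have c0 := krawCoeff_bounds s e j
        have c1 := krawCoeff_bounds s e (j + 1)
        have c2 := krawCoeff_bounds s e (j + 2)
        have d1 := krawCoeff_bounds s e (j + d + 1)
        have d2 := krawCoeff_bounds s e (j + d + 2)
        have d3 := krawCoeff_bounds s e (j + d + 3)
        have d4 := krawCoeff_bounds s e (j + d + 4)
        have hd := krawCoeff_succ_le_two_mul (M := s + e) (t := j) (by omega)
        simp only [show s + 1 + 1 + e = s + e + 1 + 1 by ring,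
          show s + 1 + e = s + e + 1 by ring] at *
        have r1 := krawCoeff_succ_right 0 (s + e) j
        have r2 := krawCoeff_succ_right 0 (s + e + 1) (j + d + 3)
        have r3 := krawCoeff_succ_right 0 (s + e) (j + d + 3)
        have r4 := krawCoeff_succ_right 0 (s + e) (j + d + 2)
        have l1 := krawCoeff_succ_left (s + 1) e (j + 1)
        have l2 := krawCoeff_succ_left (s + 1) e (j + d + 3)
        have l3 := krawCoeff_succ_left (s + 1) e (j + d + 2)
        have l4 := krawCoeff_succ_left s e (j + 1)
        have l5 := krawCoeff_succ_left s e j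
        have l6 := krawCoeff_succ_left s e (j + d + 3)
        have l7 := krawCoeff_succ_left s e (j + d + 2)
        have l8 := krawCoeff_succ_left s e (j + d + 1)
        linarith

/-- A codeword with `v = 0` is supported on the ball of radius `k₂`, hence is light. -/
lemma cwt_zero_le {m k₁ k₂ : ℕ} (hk₁ : 1 ≤ k₁) (hk : k₁ < k₂) (hk₂ : 2 * k₂ + 1 ≤ m)
    (u r : ZMod 3) : 3 * (cwt m k₁ k₂ u r 0 : ℤ) ≤ 2 * 3 ^ m := by
  have h := three_mul_cwt hk₁ hk u r (0 : Fin m → ZMod 3)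
  simp only [hammingNorm_zero, pow_zero, one_mul, Nat.sub_zero] at h
  have hle : ∑ t ∈ range (m + 1), (if radial k₁ k₂ u r t ≠ 0 then 1 else 0) * krawCoeff 0 m t
      ≤ ∑ t ∈ range (k₂ + 1), krawCoeff 0 m t := by
    rw [← sum_range_indicator (show k₂ + 1 ≤ m + 1 by omega)]
    refine sum_le_sum fun t _ =>
      mul_le_mul_of_nonneg_right ?_ (krawCoeff_zero_left_nonneg m t)
    by_cases ht : t < k₂ + 1
    · rw [if_pos ht]; split_ifs <;> norm_num
    · have hr : radial k₁ k₂ u r t = 0 := by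
        have h1 : ¬ t ≤ k₂ := by omega
        have h2 : ¬ t ≤ k₂ - 1 := by omega
        have h3 : ¬ t = k₂ := by omega
        simp [radial, h1, h2, h3]
      simp [hr, ht]
  have hball := sum_krawCoeff_le (M := m) (k := k₂) (by omega)
  have hdouble := two_mul_krawCoeff_le (M := m) (t := k₂) hk₂
  have htwo : krawCoeff 0 m k₂ + krawCoeff 0 m (k₂ + 1) ≤ 3 ^ m := by
    have hall := sum_krawCoeff_all 0 m
    simp only [zero_add, pow_zero, one_mul] at hall
    rw [← hall, ← sum_pair (show k₂ ≠ k₂ + 1 by omega)]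
    refine sum_le_sum_of_subset_of_nonneg ?_ fun t _ _ => krawCoeff_zero_left_nonneg m t
    intro t ht
    simp only [mem_insert, mem_singleton] at ht
    rw [mem_range]
    omega
  linarith

theorem stmt15 (m k₁ k₂ : ℕ) (hm : 9 ≤ m) (hk₁ : 2 ≤ k₁) (hk : k₁ + 1 < k₂)
    (hk₂ : k₂ ≤ (m - 1) / 2) :
    IsGreatest {w : ℤ | ∃ (u r : ZMod 3) (v : Fin m → ZMod 3),
        cw m k₁ k₂ u r v ≠ 0 ∧ w = (cwt m k₁ k₂ u r v : ℤ)}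
      ((3 : ℤ) ^ m - 3 ^ (m - 1) + 2 ^ k₂ * ((m - 1).choose k₂ : ℤ)
        - 2 ^ (k₁ - 1) * ((m - 1).choose (k₁ - 1) : ℤ)) := by
  rw [← krawCoeff_zero_left, ← krawCoeff_zero_left]
  have hpow : (3 : ℤ) ^ m = 3 * 3 ^ (m - 1) := by
    rw [← pow_succ']; congr 1; omega
  have hpos : (0 : ℤ) < 3 ^ (m - 1) := by positivity
  constructor
  · let i₀ : Fin m := ⟨0, by omega⟩
    have hv : hammingNorm (Pi.single i₀ 1 : Fin m → ZMod 3) = 0 + 1 := by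
      simp [hammingNorm, Pi.single_apply, filter_eq']
    have hw := cwt_of_hammingNorm_eq_succ (e := m - 1) hk₁ hk (by omega) 0 1 hv (by omega)
    have h10 : (1 : ZMod 3) ≠ 0 := by decide
    have h20 : (0 - 1 : ZMod 3) ≠ 0 := by decide
    rw [if_neg (not_not.2 rfl), if_pos h10, zero_add (1 : ZMod 3), if_pos h10, if_pos h20]
      at hw
    refine ⟨0, 1, Pi.single i₀ 1, fun h0 => ?_, by linarith⟩
    have hcwt : cwt m k₁ k₂ 0 1 (Pi.single i₀ 1) = 0 := by simp [cwt, h0]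
    have hT := (krawCoeff_combination_le (s := 0) (e := m - 1) hk₁ hk (by omega)).1
    rw [hcwt, Nat.cast_zero] at hw
    rw [zero_add] at hT
    linarith
  · rintro w ⟨u, r, v, -, rfl⟩
    by_cases hv : v = 0
    · subst hv
      have hz := cwt_zero_le (m := m) (by omega : 1 ≤ k₁) (by omega : k₁ < k₂) (by omega) u r
      have hT := (krawCoeff_combination_le (s := 0) (e := m - 1) hk₁ hk (by omega)).1
      rw [zero_add] at hT
      linarith
    · have hpos' := hammingNorm_pos_iff.2 hv
      have hle := hammingNorm_le v
      obtain ⟨s, hs⟩ : ∃ s, hammingNorm v = s + 1 := ⟨hammingNorm v - 1, by omega⟩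
      obtain ⟨e, he⟩ : ∃ e, m = s + 1 + e := ⟨m - (s + 1), by omega⟩
      obtain ⟨t0, t1, t2, t3, t4⟩ :=
        krawCoeff_combination_le (s := s) (e := e) hk₁ hk (by omega)
      rw [cwt_of_hammingNorm_eq_succ hk₁ hk (by omega) u r hs he,
        show m - 1 = s + e by omega]
      have hcases : (u = 0 ∧ r = 0) ∨ (u = 0 ∧ r ≠ 0 ∧ u + r ≠ 0 ∧ u - r ≠ 0)
          ∨ (u ≠ 0 ∧ r = 0 ∧ u + r ≠ 0 ∧ u - r ≠ 0)
          ∨ (u ≠ 0 ∧ r ≠ 0 ∧ u + r ≠ 0 ∧ u - r = 0)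
          ∨ (u ≠ 0 ∧ r ≠ 0 ∧ u + r = 0 ∧ u - r ≠ 0) := by
        clear * -
        revert u r; decide
      rcases hcases with ⟨a, b⟩ | ⟨a, b, c, d⟩ | ⟨a, b, c, d⟩ | ⟨a, b, c, d⟩ | ⟨a, b, c, d⟩
      · simp only [a, b, add_zero, sub_zero, ne_eq, not_true_eq_false, if_false]
        linarith
      · rw [if_neg (not_not.2 a), if_pos b, if_pos c, if_pos d]; linarith
      · rw [if_pos a, if_neg (not_not.2 b), if_pos c, if_pos d]; linarith
      · rw [if_pos a, if_pos b, if_pos c, if_neg (not_not.2 d)]; linarith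
      · rw [if_pos a, if_pos b, if_neg (not_not.2 c), if_pos d]; linarith
end

section
/- Let m, t, i be integers with 0 ≤ i ≤ m and t ≥ 0. Then 2^t·C(m,t) + 2·K_t(i,m) = Σ_{j=0}^t 2^{t−j}·(2^j + 2·(−1)^j)·C(i,j)·C(m−i,t−j); in particular 2^t·C(m,t) + 2·K_t(i,m) ≥ 0. -/
open Finset

theorem two_pow_mul_choose_eq_sum {m i : ℕ} (him : i ≤ m) (t : ℕ) :
    (2 : ℤ) ^ t * (m.choose t : ℤ)
      = ∑ j ∈ Finset.range (t + 1),
          2 ^ (t - j) * (2 : ℤ) ^ j * (i.choose j : ℤ) * ((m - i).choose (t - j) : ℤ) := by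
  have vandermonde := Nat.add_choose_eq i (m - i) t
  rw [Nat.add_sub_cancel' him, Finset.Nat.sum_antidiagonal_eq_sum_range_succ_mk] at vandermonde
  rw [vandermonde, Nat.cast_sum, Finset.mul_sum]
  refine Finset.sum_congr rfl fun j hj => ?_
  rw [pow_sub_mul_pow (2 : ℤ) (Finset.mem_range_succ_iff.mp hj)]
  push_cast
  ring

theorem two_pow_add_two_mul_neg_one_pow_nonneg (j : ℕ) : 0 ≤ (2 : ℤ) ^ j + 2 * (-1) ^ j := by
  rcases j with _ | j
  · norm_num
  · have h : (1 : ℤ) ≤ 2 ^ j := one_le_pow₀ one_le_two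
    rcases neg_one_pow_eq_or ℤ (j + 1) with h' | h' <;> rw [h', pow_succ] <;> linarith

theorem stmt17 (m t i : ℕ) (him : i ≤ m) :
    (2 : ℤ) ^ t * (m.choose t : ℤ) + 2 * Kraw t i m
      = ∑ j ∈ Finset.range (t + 1),
          2 ^ (t - j) * ((2 : ℤ) ^ j + 2 * (-1) ^ j) * (i.choose j : ℤ)
            * ((m - i).choose (t - j) : ℤ) ∧
    0 ≤ (2 : ℤ) ^ t * (m.choose t : ℤ) + 2 * Kraw t i m := by
  have expansion : (2 : ℤ) ^ t * (m.choose t : ℤ) + 2 * Kraw t i m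
      = ∑ j ∈ Finset.range (t + 1),
          2 ^ (t - j) * ((2 : ℤ) ^ j + 2 * (-1) ^ j) * (i.choose j : ℤ)
            * ((m - i).choose (t - j) : ℤ) := by
    rw [two_pow_mul_choose_eq_sum him, Kraw, Finset.mul_sum, ← Finset.sum_add_distrib]
    exact Finset.sum_congr rfl fun j _ => by ring
  refine ⟨expansion, expansion ▸ Finset.sum_nonneg fun j _ => ?_⟩
  have h := two_pow_add_two_mul_neg_one_pow_nonneg j
  positivity
end

section
/- Let m, t, i be integers with 0 ≤ i ≤ m and t ≥ 0. Then 2^t·C(m,t) − K_t(i,m) = Σ_{j=0}^t 2^{t−j}·(2^j − (−1)^j)·C(i,j)·C(m−i,t−j); in particular 2^t·C(m,t) − K_t(i,m) ≥ 0. -/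
open Finset

/-- Vandermonde's identity for the binomial coefficients of `i + (m - i) = m`, indexed by a range. -/
theorem choose_eq_sum_range_choose_mul_choose_sub {m i : ℕ} (him : i ≤ m) (t : ℕ) :
    m.choose t = ∑ j ∈ Finset.range (t + 1), i.choose j * (m - i).choose (t - j) := by
  conv_lhs => rw [← Nat.add_sub_cancel' him]
  rw [Nat.add_choose_eq, Finset.Nat.sum_antidiagonal_eq_sum_range_succ_mk]

theorem stmt18 (m t i : ℕ) (him : i ≤ m) :
    (2 : ℤ) ^ t * (m.choose t : ℤ) - Kraw t i m
      = ∑ j ∈ Finset.range (t + 1),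
          2 ^ (t - j) * ((2 : ℤ) ^ j - (-1) ^ j) * (i.choose j : ℤ)
            * ((m - i).choose (t - j) : ℤ) ∧
    0 ≤ (2 : ℤ) ^ t * (m.choose t : ℤ) - Kraw t i m := by
  have expansion : (2 : ℤ) ^ t * (m.choose t : ℤ) - Kraw t i m
      = ∑ j ∈ Finset.range (t + 1),
          2 ^ (t - j) * ((2 : ℤ) ^ j - (-1) ^ j) * (i.choose j : ℤ)
            * ((m - i).choose (t - j) : ℤ) := by
    rw [choose_eq_sum_range_choose_mul_choose_sub him t, Kraw]
    push_cast
    rw [Finset.mul_sum, ← Finset.sum_sub_distrib]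
    refine Finset.sum_congr rfl fun j hj => ?_
    have hpow : (2 : ℤ) ^ t = 2 ^ (t - j) * 2 ^ j := by
      rw [← pow_add, Nat.sub_add_cancel (Nat.lt_succ_iff.mp (Finset.mem_range.mp hj))]
    rw [hpow]
    ring
  refine ⟨expansion, expansion ▸ Finset.sum_nonneg fun j _ => ?_⟩
  have hsign : (-1 : ℤ) ^ j ≤ 2 ^ j :=
    calc (-1 : ℤ) ^ j ≤ |(-1 : ℤ) ^ j| := le_abs_self _
      _ = 1 := by simp
      _ ≤ 2 ^ j := one_le_pow₀ (by norm_num)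
  have hdiff : (0 : ℤ) ≤ 2 ^ j - (-1) ^ j := sub_nonneg.mpr hsign
  positivity
end

section
/- Let m, k₁, k₂ be integers with m ≥ 9 and 2 ≤ k₁ < k₁ + 1 < k₂ ≤ ⌊(m−1)/2⌋, and let f, g be the characteristic-type functions defined from the weight classes A, B, C, D. Then −2·Re(f̂(0)) + Re(ĝ(0)) + Re((f+g)^∧(0)) + Re((f−g)^∧(0)) = 3^m − (9/2)·2^{k₁}·C(m,k₁); in particular this quantity is not equal to 3^m. -/
open Finset

/-- The functions with support exactly `s` form a box of nonzero values on `s` and zeros off `s`. -/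
theorem card_filter_support_eq {ι α : Type*} [Fintype ι] [DecidableEq ι] [Fintype α]
    [DecidableEq α] [Zero α] (s : Finset ι) :
    #{x : ι → α | ({i | x i ≠ 0} : Finset ι) = s} = (Fintype.card α - 1) ^ #s := by
  have box : ({x : ι → α | ({i | x i ≠ 0} : Finset ι) = s} : Finset (ι → α)) =
      Fintype.piFinset fun i => if i ∈ s then ({0}ᶜ : Finset α) else {0} := by
    ext x
    simp only [mem_filter_univ, Fintype.mem_piFinset, Finset.ext_iff]
    refine forall_congr' fun i => ?_
    by_cases hi : i ∈ s <;> simp [hi]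
  rw [box, Fintype.card_piFinset]
  simp only [apply_ite Finset.card, card_compl, card_singleton, prod_ite_mem, univ_inter,
    prod_const]

/-- The number of words of Hamming weight `k`. -/
theorem card_filter_hammingNorm_eq {ι α : Type*} [Fintype ι] [DecidableEq ι] [Fintype α]
    [DecidableEq α] [Zero α] (k : ℕ) :
    #{x : ι → α | hammingNorm x = k} =
      (Fintype.card α - 1) ^ k * (Fintype.card ι).choose k := by
  have maps : ∀ x ∈ ({x : ι → α | hammingNorm x = k} : Finset (ι → α)),
      ({i | x i ≠ 0} : Finset ι) ∈ powersetCard k (univ : Finset ι) := fun x hx =>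
    mem_powersetCard.2 ⟨subset_univ _, (mem_filter.1 hx).2⟩
  have fiber : ∀ s ∈ powersetCard k (univ : Finset ι),
      #{x ∈ ({x : ι → α | hammingNorm x = k} : Finset (ι → α)) |
        ({i | x i ≠ 0} : Finset ι) = s} = (Fintype.card α - 1) ^ k := by
    intro s hs
    obtain ⟨-, rfl⟩ := mem_powersetCard.1 hs
    rw [← card_filter_support_eq s, filter_filter]
    congr 1
    refine filter_congr fun x _ => and_iff_right_of_imp ?_
    rintro rfl
    rfl
  rw [card_eq_sum_card_fiberwise maps, sum_congr rfl fiber, sum_const, card_powersetCard,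
    card_univ, smul_eq_mul, mul_comm]

theorem re_chi (a : ZMod 3) : (chi a).re = if a = 0 then 1 else -1 / 2 := by
  have cos_third : Real.cos (2 * Real.pi / 3) = -1 / 2 := by
    rw [show 2 * Real.pi / 3 = Real.pi - Real.pi / 3 by ring, Real.cos_pi_sub,
      Real.cos_pi_div_three]
    norm_num
  have re_exp (n : ℕ) : (zeta3 ^ n).re = Real.cos (n * (2 * Real.pi / 3)) := by
    rw [zeta3, ← Complex.exp_nat_mul, ← Complex.exp_ofReal_mul_I_re]
    congr 2
    push_cast
    ring
  rw [chi, re_exp]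
  obtain rfl | rfl | rfl : a = 0 ∨ a = 1 ∨ a = 2 := by
    revert a
    decide
  · simp
  · simpa [ZMod.val_one] using cos_third
  · have double : Real.cos (2 * (2 * Real.pi / 3)) = -1 / 2 := by
      rw [Real.cos_two_mul, cos_third]
      norm_num
    have two_ne : (2 : ZMod 3) ≠ 0 := by decide
    have val_two : (2 : ZMod 3).val = 2 := rfl
    simpa [val_two, two_ne] using double

theorem re_walsh_zero {m : ℕ} (F : (Fin m → ZMod 3) → ZMod 3) :
    (walsh F 0).re = ∑ x, if F x = 0 then (1 : ℝ) else -1 / 2 := by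
  simp [walsh, dotp, re_chi]

theorem values_ffun_gfun {m k₁ k₂ : ℕ} (hk₁ : 1 ≤ k₁) (hk : k₁ < k₂) (x : Fin m → ZMod 3) :
    (hammingNorm x = k₁ ∧ ffun m k₁ k₂ x = 0 ∧ gfun m k₁ k₂ x = 1) ∨
      (hammingNorm x ≠ k₁ ∧
        ((ffun m k₁ k₂ x = 0 ∧ gfun m k₁ k₂ x = 0) ∨
          (ffun m k₁ k₂ x = 1 ∧ gfun m k₁ k₂ x = 0) ∨
          (ffun m k₁ k₂ x = 1 ∧ gfun m k₁ k₂ x = 1) ∨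
          (ffun m k₁ k₂ x = 1 ∧ gfun m k₁ k₂ x = -1))) := by
  unfold ffun gfun
  split_ifs <;> simp <;> omega

/-- Away from weight `k₁` the summand of the Walsh combination is `1`; on it, it is `1 - 9 / 2`. -/
theorem walsh_combination_summand {m k₁ k₂ : ℕ} (hk₁ : 1 ≤ k₁) (hk : k₁ < k₂)
    (x : Fin m → ZMod 3) :
    -2 * (if ffun m k₁ k₂ x = 0 then (1 : ℝ) else -1 / 2)
        + (if gfun m k₁ k₂ x = 0 then (1 : ℝ) else -1 / 2)
        + (if (ffun m k₁ k₂ + gfun m k₁ k₂) x = 0 then (1 : ℝ) else -1 / 2)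
        + (if (ffun m k₁ k₂ - gfun m k₁ k₂) x = 0 then (1 : ℝ) else -1 / 2)
      = 1 - if hammingNorm x = k₁ then (9 / 2 : ℝ) else 0 := by
  have two_ne : (2 : ZMod 3) ≠ 0 := by decide
  simp only [Pi.add_apply, Pi.sub_apply]
  rcases values_ffun_gfun hk₁ hk x with
    ⟨h, hf, hg⟩ | ⟨h, ⟨hf, hg⟩ | ⟨hf, hg⟩ | ⟨hf, hg⟩ | ⟨hf, hg⟩⟩ <;>
  norm_num [h, hf, hg, two_ne]

theorem stmt19 (m k₁ k₂ : ℕ) (hm : 9 ≤ m) (hk₁ : 2 ≤ k₁) (hk : k₁ + 1 < k₂)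
    (hk₂ : k₂ ≤ (m - 1) / 2) :
    -2 * (walsh (ffun m k₁ k₂) (0 : Fin m → ZMod 3)).re
        + (walsh (gfun m k₁ k₂) (0 : Fin m → ZMod 3)).re
        + (walsh (ffun m k₁ k₂ + gfun m k₁ k₂) (0 : Fin m → ZMod 3)).re
        + (walsh (ffun m k₁ k₂ - gfun m k₁ k₂) (0 : Fin m → ZMod 3)).re
      = 3 ^ m - 9 / 2 * 2 ^ k₁ * (m.choose k₁ : ℝ) ∧
    -2 * (walsh (ffun m k₁ k₂) (0 : Fin m → ZMod 3)).re
        + (walsh (gfun m k₁ k₂) (0 : Fin m → ZMod 3)).re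
        + (walsh (ffun m k₁ k₂ + gfun m k₁ k₂) (0 : Fin m → ZMod 3)).re
        + (walsh (ffun m k₁ k₂ - gfun m k₁ k₂) (0 : Fin m → ZMod 3)).re
      ≠ 3 ^ m := by
  have value : -2 * (walsh (ffun m k₁ k₂) (0 : Fin m → ZMod 3)).re
        + (walsh (gfun m k₁ k₂) (0 : Fin m → ZMod 3)).re
        + (walsh (ffun m k₁ k₂ + gfun m k₁ k₂) (0 : Fin m → ZMod 3)).re
        + (walsh (ffun m k₁ k₂ - gfun m k₁ k₂) (0 : Fin m → ZMod 3)).re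
      = 3 ^ m - 9 / 2 * 2 ^ k₁ * (m.choose k₁ : ℝ) := by
    simp only [re_walsh_zero, mul_sum, ← sum_add_distrib]
    rw [sum_congr rfl fun x _ =>
        walsh_combination_summand (one_le_two.trans hk₁) (k₁.lt_succ_self.trans hk) x,
      sum_sub_distrib, ← sum_filter, sum_const, sum_const, card_filter_hammingNorm_eq]
    simp [ZMod.card]
    ring
  refine ⟨value, ?_⟩
  rw [value]
  have choose_pos : (0 : ℝ) < m.choose k₁ := by
    exact_mod_cast Nat.choose_pos (by omega)
  exact (sub_lt_self _ (by positivity)).ne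
end
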